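/- arXiv:2508.12676 — 2 statements merged into one kernel-verified Lean document; each statement's English description precedes it below -/
import Mathlib

section
/- Let u_1, u_2, u_3 ∈ ℝ with |u_i| < 1/4 for each i. Then for all x = (x_1, x_2, x_3) ∈ ℝ³ the triple series Σ_{m,n,p ≥ 0} H_{n+p}(x_1) H_{p+m}(x_2) H_{m+n}(x_3) u_1^m u_2^n u_3^p / (m! n! p!) converges absolutely and equals Δ^{−1/2} · exp( Σ_i x_i² − [ Σ_i x_i² − 4 Σ_i u_i² x_i² − 4(u_3 x_1 x_2 + u_1 x_2 x_3 + u_2 x_3 x_1) + 8(u_1 u_2 x_1 x_2 + u_2 u_3 x_2 x_3 + u_3 u_1 x_3 x_1) ] / Δ ). -/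
/-- The physicists' Hermite polynomial `H_n(x) = (-1)^n e^{x^2} (d^n/dx^n) e^{-x^2}`. -/
noncomputable def Hpoly (n : ℕ) (x : ℝ) : ℝ :=
  (-1 : ℝ) ^ n * Real.exp (x ^ 2) * iteratedDeriv n (fun y => Real.exp (-(y ^ 2))) x

open MeasureTheory Complex

/-- Recurrence form of the Hermite polynomials. -/
noncomputable def hermP : ℕ → ℝ → ℝ
  | 0, _ => 1
  | 1, x => 2 * x
  | (n + 2), x => 2 * x * hermP (n + 1) x - 2 * ((n : ℝ) + 1) * hermP n x

lemma hermP_deriv (n : ℕ) : (∀ x, HasDerivAt (hermP (n + 1)) (2 * ((n : ℝ) + 1) * hermP n x) x) ∧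
    (∀ x, HasDerivAt (hermP (n + 2)) (2 * ((n : ℝ) + 2) * hermP (n + 1) x) x) := by
  induction n with
  | zero =>
    have a : ∀ x, HasDerivAt (hermP 1) 2 x := by
      intro x
      have := (hasDerivAt_id x).const_mul (2 : ℝ)
      simpa [hermP] using this
    constructor
    · intro x
      simpa [hermP] using a x
    · intro x
      have h := (((hasDerivAt_id x).const_mul (2 : ℝ)).mul (a x)).sub_const (2 : ℝ)
      refine (h.congr_deriv ?_).congr_of_eventuallyEq (Filter.Eventually.of_forall fun y => ?_)
      · simp [hermP]; ring
      · simp [hermP]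
  | succ n ih =>
    obtain ⟨ih1, ih2⟩ := ih
    refine ⟨fun x => (ih2 x).congr_deriv (by push_cast; ring), fun x => ?_⟩
    have h := (((hasDerivAt_id x).const_mul (2 : ℝ)).mul (ih2 x)).sub
      ((ih1 x).const_mul (2 * (((n + 1 : ℕ) : ℝ) + 1)))
    refine (h.congr_deriv ?_).congr_of_eventuallyEq (Filter.Eventually.of_forall fun y => ?_)
    · simp [hermP]; ring
    · simp [hermP]

lemma iter_eq (n : ℕ) : iteratedDeriv n (fun y : ℝ => Real.exp (-(y ^ 2))) =
    fun x => (-1 : ℝ) ^ n * hermP n x * Real.exp (-(x ^ 2)) := by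
  have hg : ∀ x : ℝ, HasDerivAt (fun y : ℝ => Real.exp (-(y ^ 2)))
      (Real.exp (-(x ^ 2)) * (-(2 * x))) x := by
    intro x
    have := ((hasDerivAt_id x).pow 2).neg.exp
    simpa using this
  induction n with
  | zero => ext x; simp [hermP]
  | succ n ih =>
    rw [iteratedDeriv_succ, ih]
    ext x
    cases n with
    | zero =>
      simp only [pow_zero, hermP, one_mul]
      rw [(hg x).deriv]; ring
    | succ n =>
      have h := (((hermP_deriv n).1 x).const_mul ((-1 : ℝ) ^ (n + 1))).mul (hg x)
      refine h.deriv.trans ?_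
      simp only [hermP]
      ring

lemma Hpoly_eq (n : ℕ) (x : ℝ) : Hpoly n x = hermP n x := by
  rw [Hpoly, iter_eq]
  have h1 : Real.exp (x ^ 2) * Real.exp (-(x ^ 2)) = 1 := by
    rw [← Real.exp_add]; simp
  have h2 : ((-1 : ℝ) ^ n) * (-1) ^ n = 1 := by
    rw [← mul_pow]; simp
  linear_combination (hermP n x * ((-1 : ℝ) ^ n) * (-1) ^ n) * h1 + hermP n x * h2

/-- The complex integrand. -/
noncomputable def kern (n : ℕ) (x t : ℝ) : ℂ :=
  (2 * ((x : ℂ) + t * I)) ^ n * cexp (-(t : ℂ) ^ 2)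

lemma norm_z_sq (x t : ℝ) : ‖(x : ℂ) + t * I‖ ^ 2 = x ^ 2 + t ^ 2 := by
  rw [← Complex.normSq_eq_norm_sq, Complex.normSq_add_mul_I]

lemma norm_gauss (t : ℝ) : ‖cexp (-(t : ℂ) ^ 2)‖ = Real.exp (-t ^ 2) := by
  rw [Complex.norm_exp]; norm_cast

lemma kern_cont (n : ℕ) (x : ℝ) : Continuous (kern n x) := by
  unfold kern; fun_prop

lemma kern_integrable (n : ℕ) (x : ℝ) : Integrable (kern n x) := by
  have hb : Integrable (fun t : ℝ => (n.factorial * Real.exp (2 + x ^ 2 / 2)) *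
      Real.exp (-(1 / 2) * t ^ 2)) :=
    (integrable_exp_neg_mul_sq (by norm_num)).const_mul _
  refine hb.mono' (kern_cont n x).aestronglyMeasurable (Filter.Eventually.of_forall fun t => ?_)
  unfold kern
  rw [norm_mul, norm_pow, norm_gauss]
  set r := ‖2 * ((x : ℂ) + t * I)‖ with hr
  have hr0 : 0 ≤ r := norm_nonneg _
  have hr2 : r ^ 2 = 4 * (x ^ 2 + t ^ 2) := by
    rw [hr, norm_mul, mul_pow, norm_z_sq]; norm_num
  have h1 := Real.pow_div_factorial_le_exp r hr0 n
  rw [div_le_iff₀ (by positivity)] at h1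
  have h2 : Real.exp r ≤ Real.exp (2 + (x ^ 2 + t ^ 2) / 2) := by
    apply Real.exp_le_exp.2
    nlinarith [sq_nonneg (r - 4)]
  calc r ^ n * Real.exp (-t ^ 2)
      ≤ (Real.exp (2 + (x ^ 2 + t ^ 2) / 2) * n.factorial) * Real.exp (-t ^ 2) := by
        gcongr; exact h1.trans (by gcongr)
    _ = (n.factorial * Real.exp (2 + x ^ 2 / 2)) * Real.exp (-(1 / 2) * t ^ 2) := by
        rw [mul_comm (Real.exp _) (n.factorial : ℝ), mul_assoc, mul_assoc, ← Real.exp_add,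
          ← Real.exp_add]
        ring_nf

lemma kern_rec (n : ℕ) (x : ℝ) : ∫ t, kern (n + 2) x t =
    2 * x * (∫ t, kern (n + 1) x t) - 2 * ((n : ℂ) + 1) * (∫ t, kern n x t) := by
  have hd : ∀ t : ℝ, HasDerivAt (fun t => -I * kern (n + 1) x t)
      (kern (n + 2) x t - 2 * x * kern (n + 1) x t + 2 * ((n : ℂ) + 1) * kern n x t) t := by
    intro t
    have h0 : HasDerivAt (fun t : ℝ => (t : ℂ)) 1 t := Complex.ofRealCLM.hasDerivAt
    have h1 := ((((h0.mul_const I).const_add (x : ℂ)).const_mul 2).pow (n + 1)).mul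
      ((h0.pow 2).neg.cexp)
    have h2 := h1.const_mul (-I)
    refine (h2.congr_deriv ?_).congr_of_eventuallyEq (Filter.Eventually.of_forall fun y => ?_)
    · simp [kern]
      ring_nf
      simp only [I_sq]
      ring
    · simp [kern]
  have := integral_eq_zero_of_hasDerivAt_of_integrable hd
    ((((kern_integrable _ x).sub ((kern_integrable _ x).const_mul _))).add
      ((kern_integrable _ x).const_mul _)) ((kern_integrable _ x).const_mul _)
  rw [integral_add (f := fun t => kern (n + 2) x t - 2 * x * kern (n + 1) x t)
    ((kern_integrable _ x).sub ((kern_integrable _ x).const_mul _))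
    ((kern_integrable _ x).const_mul _), integral_sub (kern_integrable _ x)
    ((kern_integrable _ x).const_mul _), integral_const_mul, integral_const_mul] at this
  linear_combination this

lemma kern_zero (x : ℝ) : ∫ t, kern 0 x t = (Real.sqrt Real.pi : ℂ) := by
  have := integral_gaussian 1
  have h : ∀ t, kern 0 x t = ((Real.exp (-1 * t ^ 2) : ℝ) : ℂ) := by
    intro t; simp [kern]
  simp_rw [h]
  rw [integral_complex_ofReal, this]; simp

lemma kern_one (x : ℝ) : ∫ t, kern 1 x t = 2 * x * (Real.sqrt Real.pi : ℂ) := by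
  have hd : ∀ t : ℝ, HasDerivAt (fun t => -I * kern 0 x t)
      (kern 1 x t - 2 * x * kern 0 x t) t := by
    intro t
    have h0 : HasDerivAt (fun t : ℝ => (t : ℂ)) 1 t := Complex.ofRealCLM.hasDerivAt
    have h2 := ((h0.pow 2).neg.cexp).const_mul (-I)
    refine (h2.congr_deriv ?_).congr_of_eventuallyEq (Filter.Eventually.of_forall fun y => ?_)
    · simp [kern]; ring
    · simp [kern]
  have := integral_eq_zero_of_hasDerivAt_of_integrable hd
    ((kern_integrable _ x).sub ((kern_integrable _ x).const_mul _))
    ((kern_integrable _ x).const_mul _)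
  rw [integral_sub (kern_integrable _ x)
    ((kern_integrable _ x).const_mul _), integral_const_mul, kern_zero] at this
  linear_combination this

lemma kern_int (n : ℕ) (x : ℝ) :
    ∫ t, kern n x t = (Hpoly n x : ℂ) * (Real.sqrt Real.pi : ℂ) := by
  suffices h : ∫ t, kern n x t = (hermP n x : ℂ) * (Real.sqrt Real.pi : ℂ) ∧
      ∫ t, kern (n + 1) x t = (hermP (n + 1) x : ℂ) * (Real.sqrt Real.pi : ℂ) by
    rw [Hpoly_eq]; exact h.1
  induction n with
  | zero =>
    refine ⟨?_, ?_⟩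
    · rw [kern_zero]; simp [hermP]
    · rw [zero_add, kern_one]; simp [hermP]
  | succ n ih =>
    refine ⟨ih.2, ?_⟩
    rw [kern_rec, ih.1, ih.2]
    simp only [hermP]
    push_cast
    ring

lemma gauss1 (b : ℝ) (hb : 0 < b) (c d : ℂ) (f : ℝ → ℂ)
    (hf : ∀ t : ℝ, f t = cexp (-(b : ℂ) * (t : ℂ) ^ 2 + c * t + d)) :
    ∫ t : ℝ, f t = (Real.sqrt (Real.pi / b) : ℂ) * cexp (d + c ^ 2 / (4 * b)) := by
  simp_rw [hf]
  rw [integral_cexp_quadratic (by simpa using hb)]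
  congr 1
  · rw [neg_neg, Real.sqrt_eq_rpow, Complex.ofReal_cpow (by positivity)]
    push_cast; rfl
  · congr 1
    rw [mul_neg, div_neg]; ring

/-- The generating exponential. -/
noncomputable def GG (u1 u2 u3 x1 x2 x3 t1 t2 t3 : ℝ) : ℂ :=
  cexp (4 * u1 * ((x2 : ℂ) + t2 * I) * (x3 + t3 * I) + 4 * u2 * ((x1 : ℂ) + t1 * I) * (x3 + t3 * I)
    + 4 * u3 * ((x1 : ℂ) + t1 * I) * (x2 + t2 * I) - (t1 : ℂ) ^ 2 - (t2 : ℂ) ^ 2 - (t3 : ℂ) ^ 2)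

lemma triple (u1 u2 u3 x1 x2 x3 D E : ℝ) (hE : E = 1 - 4 * u1 ^ 2) (hE0 : 0 < E)
    (hD : D = 1 - 4*u1^2 - 4*u2^2 - 4*u3^2 + 16*u1*u2*u3) (hD0 : 0 < D) :
    ∫ t1 : ℝ, ∫ t2 : ℝ, ∫ t3 : ℝ, GG u1 u2 u3 x1 x2 x3 t1 t2 t3 =
    (Real.sqrt Real.pi : ℂ) * (Real.sqrt (Real.pi / E) : ℂ) * (Real.sqrt (Real.pi / (D / E)) : ℂ) *
    cexp ((x1^2 + x2^2 + x3^2) -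
          ((x1^2 + x2^2 + x3^2) - 4*(u1^2*x1^2 + u2^2*x2^2 + u3^2*x3^2)
            - 4*(u3*x1*x2 + u1*x2*x3 + u2*x3*x1)
            + 8*(u1*u2*x1*x2 + u2*u3*x2*x3 + u3*u1*x3*x1)) / D) := by
  have hEc : (E : ℂ) ≠ 0 := by exact_mod_cast hE0.ne'
  have hDc : (D : ℂ) ≠ 0 := by exact_mod_cast hD0.ne'
  have hE' : (E : ℂ) = 1 - 4 * u1 ^ 2 := by rw [hE]; push_cast; ring
  have hD' : (D : ℂ) = 1 - 4*u1^2 - 4*u2^2 - 4*u3^2 + 16*u1*u2*u3 := by rw [hD]; push_cast; ring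
  -- first integral
  have s3 : ∀ t1 t2 : ℝ, ∫ t3 : ℝ, GG u1 u2 u3 x1 x2 x3 t1 t2 t3 =
      (Real.sqrt Real.pi : ℂ) * cexp (-(E : ℂ) * (t2 : ℂ) ^ 2 +
        (I * (4 * u1 * x3 + 4 * u3 * (x1 + t1 * I) - 8 * u1 ^ 2 * x2
          - 8 * u1 * u2 * (x1 + t1 * I))) * t2 +
        (4 * u1 * x2 * x3 + 4 * u2 * (x1 + t1 * I) * x3 + 4 * u3 * (x1 + t1 * I) * x2
          - 4 * (u1 * x2 + u2 * (x1 + t1 * I)) ^ 2 - (t1 : ℂ) ^ 2)) := by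
    intro t1 t2
    rw [gauss1 1 one_pos (4 * I * (u1 * (x2 + t2 * I) + u2 * (x1 + t1 * I)))
      (4 * u1 * (x2 + t2 * I) * x3 + 4 * u2 * (x1 + t1 * I) * x3
        + 4 * u3 * (x1 + t1 * I) * (x2 + t2 * I) - (t1 : ℂ) ^ 2 - (t2 : ℂ) ^ 2)]
    · rw [div_one]
      congr 2
      rw [hE']
      push_cast
      ring_nf
      simp only [I_sq, I_pow_three, I_pow_four]
      ring
    · intro t; unfold GG
      congr 1
      push_cast
      ring
  simp_rw [s3, integral_const_mul]
  have s2 : ∀ t1 : ℝ, ∫ t2 : ℝ, cexp (-(E : ℂ) * (t2 : ℂ) ^ 2 +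
        (I * (4 * u1 * x3 + 4 * u3 * (x1 + t1 * I) - 8 * u1 ^ 2 * x2
          - 8 * u1 * u2 * (x1 + t1 * I))) * t2 +
        (4 * u1 * x2 * x3 + 4 * u2 * (x1 + t1 * I) * x3 + 4 * u3 * (x1 + t1 * I) * x2
          - 4 * (u1 * x2 + u2 * (x1 + t1 * I)) ^ 2 - (t1 : ℂ) ^ 2)) =
      (Real.sqrt (Real.pi / E) : ℂ) * cexp (-((D / E : ℝ) : ℂ) * (t1 : ℂ) ^ 2 +
        (I * (4 * u2 * x3 + 4 * u3 * x2 - 8 * u1 * u2 * x2 - 8 * u2 ^ 2 * x1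
          - 8 * (u1 * x3 + u3 * x1 - 2 * u1 ^ 2 * x2 - 2 * u1 * u2 * x1) * (u3 - 2 * u1 * u2) / E))
          * t1 +
        (4 * u1 * x2 * x3 + 4 * u2 * x1 * x3 + 4 * u3 * x1 * x2 - 4 * (u1 * x2 + u2 * x1) ^ 2
          - 4 * (u1 * x3 + u3 * x1 - 2 * u1 ^ 2 * x2 - 2 * u1 * u2 * x1) ^ 2 / E)) := by
    intro t1
    rw [gauss1 E hE0 _ _ _ (fun t => rfl)]
    congr 2
    push_cast
    field_simp
    rw [hD', hE']
    ring_nf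
    simp only [I_sq, I_pow_three, I_pow_four]
    ring
  simp_rw [s2, integral_const_mul]
  rw [gauss1 (D / E) (by positivity) _ _ _ (fun t => rfl)]
  rw [← mul_assoc, ← mul_assoc]
  congr 2
  push_cast
  field_simp
  simp only [I_sq]
  rw [hD', hE']
  ring

lemma HasSum.congr_val {ι : Type*} {f : ι → ℂ} {a b : ℂ} (h : HasSum f a) (e : b = a) :
    HasSum f b := e ▸ h

lemma HasSum.congr_both {ι : Type*} {f g : ι → ℂ} {a b : ℂ} (h : HasSum f a)
    (e' : ∀ i, g i = f i) (e : b = a) : HasSum g b := by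
  obtain rfl : g = f := funext e'
  exact e ▸ h

lemma hasSum_mul_c {ι κ : Type*} {f : ι → ℂ} {g : κ → ℂ} {a b : ℂ} (hf : HasSum f a)
    (hg : HasSum g b) : HasSum (fun p : ι × κ => f p.1 * g p.2) (a * b) :=
  hf.mul hg (summable_mul_of_summable_norm hf.summable.norm hg.summable.norm)

lemma hasSum_cexp (z : ℂ) : HasSum (fun n : ℕ => z ^ n / (n.factorial : ℂ)) (cexp z) := by
  rw [Complex.exp_eq_exp_ℂ]
  exact NormedSpace.expSeries_div_hasSum_exp z

lemma hasSum_mul_c3 {f g h : ℕ → ℂ} {a b c : ℂ} (hf : HasSum f a) (hg : HasSum g b)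
    (hh : HasSum h c) :
    HasSum (fun q : ℕ × ℕ × ℕ => f q.1 * (g q.2.1 * h q.2.2)) (a * (b * c)) := by
  have h2 := hasSum_mul_c hg hh
  have h3 := hasSum_mul_c hf h2
  exact h3

lemma hasSum_exp3 (a b c : ℂ) : HasSum (fun q : ℕ × ℕ × ℕ =>
    a ^ q.1 / (q.1.factorial : ℂ) * (b ^ q.2.1 / (q.2.1.factorial : ℂ) *
      (c ^ q.2.2 / (q.2.2.factorial : ℂ)))) (cexp a * (cexp b * cexp c)) :=
  hasSum_mul_c3 (f := fun n => a ^ n / (n.factorial : ℂ)) (g := fun n => b ^ n / (n.factorial : ℂ))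
    (h := fun n => c ^ n / (n.factorial : ℂ)) (hasSum_cexp a) (hasSum_cexp b) (hasSum_cexp c)

/-- The integrand of the general term. -/
noncomputable def FF (u1 u2 u3 x1 x2 x3 : ℝ) (q : ℕ × ℕ × ℕ) (t : ℝ × ℝ × ℝ) : ℂ :=
  kern (q.2.1 + q.2.2) x1 t.1 * (kern (q.2.2 + q.1) x2 t.2.1 * kern (q.1 + q.2.1) x3 t.2.2) *
    (u1 ^ q.1 * u2 ^ q.2.1 * u3 ^ q.2.2 /
      ((q.1.factorial : ℂ) * (q.2.1.factorial : ℂ) * (q.2.2.factorial : ℂ)))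

lemma FF_alg (u1 u2 u3 z1 z2 z3 e1 e2 e3 f1 f2 f3 : ℂ) (m n p : ℕ) :
    (2 * z1) ^ (n + p) * e1 * ((2 * z2) ^ (p + m) * e2 * ((2 * z3) ^ (m + n) * e3)) *
      (u1 ^ m * u2 ^ n * u3 ^ p / (f1 * f2 * f3)) =
    (4 * u1 * z2 * z3) ^ m / f1 * ((4 * u2 * z1 * z3) ^ n / f2 * ((4 * u3 * z1 * z2) ^ p / f3)) *
      (e1 * (e2 * e3)) := by
  have a1 : 4 * u1 * z2 * z3 = u1 * ((2 * z2) * (2 * z3)) := by ring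
  have a2 : 4 * u2 * z1 * z3 = u2 * ((2 * z1) * (2 * z3)) := by ring
  have a3 : 4 * u3 * z1 * z2 = u3 * ((2 * z1) * (2 * z2)) := by ring
  rw [a1, a2, a3]
  generalize 2 * z1 = w1
  generalize 2 * z2 = w2
  generalize 2 * z3 = w3
  rw [mul_pow u1, mul_pow u2, mul_pow u3, mul_pow, mul_pow, mul_pow, pow_add, pow_add, pow_add]
  ring

lemma FF_eq (u1 u2 u3 x1 x2 x3 : ℝ) (q : ℕ × ℕ × ℕ) (t : ℝ × ℝ × ℝ) :
    FF u1 u2 u3 x1 x2 x3 q t =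
    (4 * u1 * ((x2 : ℂ) + t.2.1 * I) * (x3 + t.2.2 * I)) ^ q.1 / (q.1.factorial : ℂ) *
    ((4 * u2 * ((x1 : ℂ) + t.1 * I) * (x3 + t.2.2 * I)) ^ q.2.1 / (q.2.1.factorial : ℂ) *
    ((4 * u3 * ((x1 : ℂ) + t.1 * I) * (x2 + t.2.1 * I)) ^ q.2.2 / (q.2.2.factorial : ℂ))) *
    (cexp (-(t.1 : ℂ) ^ 2) * (cexp (-(t.2.1 : ℂ) ^ 2) * cexp (-(t.2.2 : ℂ) ^ 2))) := by
  unfold FF kern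
  generalize cexp (-(t.1 : ℂ) ^ 2) = e1
  generalize cexp (-(t.2.1 : ℂ) ^ 2) = e2
  generalize cexp (-(t.2.2 : ℂ) ^ 2) = e3
  generalize (x1 : ℂ) + t.1 * I = z1
  generalize (x2 : ℂ) + t.2.1 * I = z2
  generalize (x3 : ℂ) + t.2.2 * I = z3
  exact FF_alg _ _ _ _ _ _ _ _ _ _ _ _ _ _ _

lemma FF_hasSum (u1 u2 u3 x1 x2 x3 : ℝ) (t : ℝ × ℝ × ℝ) :
    HasSum (fun q => FF u1 u2 u3 x1 x2 x3 q t) (GG u1 u2 u3 x1 x2 x3 t.1 t.2.1 t.2.2) := by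
  simp_rw [FF_eq]
  have h := (hasSum_exp3 (4 * u1 * ((x2 : ℂ) + t.2.1 * I) * (x3 + t.2.2 * I))
    (4 * u2 * ((x1 : ℂ) + t.1 * I) * (x3 + t.2.2 * I))
    (4 * u3 * ((x1 : ℂ) + t.1 * I) * (x2 + t.2.1 * I))).mul_right
    (cexp (-(t.1 : ℂ) ^ 2) * (cexp (-(t.2.1 : ℂ) ^ 2) * cexp (-(t.2.2 : ℂ) ^ 2)))
  refine HasSum.congr_val h ?_
  unfold GG
  simp only [← Complex.exp_add]
  congr 1
  ring

/-- Sum of the norms. -/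
noncomputable def BB (u1 u2 u3 x1 x2 x3 : ℝ) (t : ℝ × ℝ × ℝ) : ℝ :=
  Real.exp (4 * |u1| * ‖(x2 : ℂ) + t.2.1 * I‖ * ‖(x3 : ℂ) + t.2.2 * I‖
    + 4 * |u2| * ‖(x1 : ℂ) + t.1 * I‖ * ‖(x3 : ℂ) + t.2.2 * I‖
    + 4 * |u3| * ‖(x1 : ℂ) + t.1 * I‖ * ‖(x2 : ℂ) + t.2.1 * I‖
    - t.1 ^ 2 - t.2.1 ^ 2 - t.2.2 ^ 2)

lemma FF_norm_hasSum (u1 u2 u3 x1 x2 x3 : ℝ) (t : ℝ × ℝ × ℝ) :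
    HasSum (fun q => ‖FF u1 u2 u3 x1 x2 x3 q t‖) (BB u1 u2 u3 x1 x2 x3 t) := by
  simp_rw [FF_eq, norm_mul, norm_div, norm_pow, norm_mul, norm_gauss]
  have h := (hasSum_exp3
    ((4 * |u1| * ‖(x2 : ℂ) + t.2.1 * I‖ * ‖(x3 : ℂ) + t.2.2 * I‖ : ℝ) : ℂ)
    ((4 * |u2| * ‖(x1 : ℂ) + t.1 * I‖ * ‖(x3 : ℂ) + t.2.2 * I‖ : ℝ) : ℂ)
    ((4 * |u3| * ‖(x1 : ℂ) + t.1 * I‖ * ‖(x2 : ℂ) + t.2.1 * I‖ : ℝ) : ℂ)).mul_right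
    (((Real.exp (-t.1 ^ 2) * (Real.exp (-t.2.1 ^ 2) * Real.exp (-t.2.2 ^ 2)) : ℝ)) : ℂ)
  rw [← Complex.hasSum_ofReal]
  refine HasSum.congr_both h ?_ ?_
  · intro q
    simp
  · unfold BB
    simp only [← Complex.ofReal_exp, ← Complex.ofReal_mul, ← Real.exp_add]
    congr 2
    ring

lemma FF_cont (u1 u2 u3 x1 x2 x3 : ℝ) (q : ℕ × ℕ × ℕ) : Continuous (FF u1 u2 u3 x1 x2 x3 q) := by
  unfold FF kern; fun_prop

lemma BB_integrable (u1 u2 u3 : ℝ) (h1 : |u1| < 1/4) (h2 : |u2| < 1/4) (h3 : |u3| < 1/4)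
    (x1 x2 x3 : ℝ) : Integrable (BB u1 u2 u3 x1 x2 x3) := by
  obtain ⟨k, hk1, k1, k2, k3⟩ : ∃ k : ℝ, k < 1 ∧ 4 * |u1| ≤ k ∧ 4 * |u2| ≤ k ∧ 4 * |u3| ≤ k := by
    refine ⟨max (4 * |u1|) (max (4 * |u2|) (4 * |u3|)), ?_, by simp, by simp, by simp⟩
    refine max_lt (by linarith) (max_lt (by linarith) (by linarith))
  have hk0 : 0 ≤ k := le_trans (by positivity) k1
  have hg : ∀ x : ℝ, Integrable (fun t : ℝ => Real.exp (k * x ^ 2) * Real.exp (-(1 - k) * t ^ 2)) :=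
    fun x => (integrable_exp_neg_mul_sq (by linarith)).const_mul _
  have hI := (hg x1).mul_prod ((hg x2).mul_prod (hg x3))
  refine hI.mono' ?_ (Filter.Eventually.of_forall fun t => ?_)
  · refine Continuous.aestronglyMeasurable ?_
    unfold BB; fun_prop
  · unfold BB
    rw [Real.norm_of_nonneg (Real.exp_pos _).le]
    simp only [← Real.exp_add]
    apply Real.exp_le_exp.2
    have n1 := norm_z_sq x1 t.1
    have n2 := norm_z_sq x2 t.2.1
    have n3 := norm_z_sq x3 t.2.2
    have p1 := norm_nonneg ((x1 : ℂ) + t.1 * I)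
    have p2 := norm_nonneg ((x2 : ℂ) + t.2.1 * I)
    have p3 := norm_nonneg ((x3 : ℂ) + t.2.2 * I)
    set r1 := ‖(x1 : ℂ) + t.1 * I‖
    set r2 := ‖(x2 : ℂ) + t.2.1 * I‖
    set r3 := ‖(x3 : ℂ) + t.2.2 * I‖
    have e1 : 4 * |u1| * r2 * r3 ≤ k * r2 * r3 := by gcongr
    have e2 : 4 * |u2| * r1 * r3 ≤ k * r1 * r3 := by gcongr
    have e3 : 4 * |u3| * r1 * r2 ≤ k * r1 * r2 := by gcongr
    have e4 : k * (r2 * r3 + r1 * r3 + r1 * r2) ≤ k * (r1 ^ 2 + r2 ^ 2 + r3 ^ 2) := by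
      refine mul_le_mul_of_nonneg_left ?_ hk0
      nlinarith [sq_nonneg (r1 - r2), sq_nonneg (r1 - r3), sq_nonneg (r2 - r3)]
    rw [n1, n2, n3] at e4
    linarith

lemma FF_integral (u1 u2 u3 x1 x2 x3 : ℝ) (q : ℕ × ℕ × ℕ) :
    ∫ t, FF u1 u2 u3 x1 x2 x3 q t = ((Hpoly (q.2.1 + q.2.2) x1 * Hpoly (q.2.2 + q.1) x2 *
      Hpoly (q.1 + q.2.1) x3 * u1 ^ q.1 * u2 ^ q.2.1 * u3 ^ q.2.2 /
        ((q.1.factorial : ℝ) * (q.2.1.factorial : ℝ) * (q.2.2.factorial : ℝ)) : ℝ) : ℂ) *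
      (Real.sqrt Real.pi : ℂ) ^ 3 := by
  unfold FF
  rw [integral_mul_const]
  have e1 := integral_prod_mul (μ := (volume : Measure ℝ)) (ν := (volume : Measure (ℝ × ℝ)))
    (kern (q.2.1 + q.2.2) x1)
    (fun s : ℝ × ℝ => kern (q.2.2 + q.1) x2 s.1 * kern (q.1 + q.2.1) x3 s.2)
  have e2 := integral_prod_mul (μ := (volume : Measure ℝ)) (ν := (volume : Measure ℝ))
    (kern (q.2.2 + q.1) x2) (kern (q.1 + q.2.1) x3)
  rw [← Measure.volume_eq_prod] at e1 e2
  rw [e1, e2, kern_int, kern_int, kern_int]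
  push_cast
  ring

theorem stmt7 (u1 u2 u3 : ℝ) (h1 : |u1| < 1/4) (h2 : |u2| < 1/4) (h3 : |u3| < 1/4)
    (x1 x2 x3 : ℝ) :
    Summable (fun q : ℕ × ℕ × ℕ =>
      |Hpoly (q.2.1 + q.2.2) x1 * Hpoly (q.2.2 + q.1) x2 * Hpoly (q.1 + q.2.1) x3 *
        u1 ^ q.1 * u2 ^ q.2.1 * u3 ^ q.2.2 /
        ((q.1.factorial : ℝ) * (q.2.1.factorial : ℝ) * (q.2.2.factorial : ℝ))|) ∧
    (∑' q : ℕ × ℕ × ℕ,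
        Hpoly (q.2.1 + q.2.2) x1 * Hpoly (q.2.2 + q.1) x2 * Hpoly (q.1 + q.2.1) x3 *
          u1 ^ q.1 * u2 ^ q.2.1 * u3 ^ q.2.2 /
          ((q.1.factorial : ℝ) * (q.2.1.factorial : ℝ) * (q.2.2.factorial : ℝ)))
      = (1 - 4*u1^2 - 4*u2^2 - 4*u3^2 + 16*u1*u2*u3) ^ (-(1:ℝ)/2) *
        Real.exp ((x1^2 + x2^2 + x3^2) -
          ((x1^2 + x2^2 + x3^2) - 4*(u1^2*x1^2 + u2^2*x2^2 + u3^2*x3^2)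
            - 4*(u3*x1*x2 + u1*x2*x3 + u2*x3*x1)
            + 8*(u1*u2*x1*x2 + u2*u3*x2*x3 + u3*u1*x3*x1)) /
          (1 - 4*u1^2 - 4*u2^2 - 4*u3^2 + 16*u1*u2*u3)) := by
  set T : ℕ × ℕ × ℕ → ℝ := fun q =>
    Hpoly (q.2.1 + q.2.2) x1 * Hpoly (q.2.2 + q.1) x2 * Hpoly (q.1 + q.2.1) x3 *
      u1 ^ q.1 * u2 ^ q.2.1 * u3 ^ q.2.2 /
      ((q.1.factorial : ℝ) * (q.2.1.factorial : ℝ) * (q.2.2.factorial : ℝ)) with hT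
  have hBB := BB_integrable u1 u2 u3 h1 h2 h3 x1 x2 x3
  have hmain := hasSum_integral_of_dominated_convergence (μ := (volume : Measure (ℝ × ℝ × ℝ)))
    (F := FF u1 u2 u3 x1 x2 x3) (f := fun t => GG u1 u2 u3 x1 x2 x3 t.1 t.2.1 t.2.2)
    (fun q t => ‖FF u1 u2 u3 x1 x2 x3 q t‖)
    (fun q => (FF_cont u1 u2 u3 x1 x2 x3 q).aestronglyMeasurable)
    (fun q => Filter.Eventually.of_forall fun t => le_rfl)
    (Filter.Eventually.of_forall fun t => (FF_norm_hasSum u1 u2 u3 x1 x2 x3 t).summable)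
    (by
      simp_rw [fun t => (FF_norm_hasSum u1 u2 u3 x1 x2 x3 t).tsum_eq]
      exact hBB)
    (Filter.Eventually.of_forall fun t => FF_hasSum u1 u2 u3 x1 x2 x3 t)
  have hGcont : Continuous (fun t : ℝ × ℝ × ℝ => GG u1 u2 u3 x1 x2 x3 t.1 t.2.1 t.2.2) := by
    unfold GG; fun_prop
  have hGint : Integrable (fun t : ℝ × ℝ × ℝ => GG u1 u2 u3 x1 x2 x3 t.1 t.2.1 t.2.2) := by
    refine hBB.mono' hGcont.aestronglyMeasurable (Filter.Eventually.of_forall fun t => ?_)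
    rw [← (FF_hasSum u1 u2 u3 x1 x2 x3 t).tsum_eq, ← (FF_norm_hasSum u1 u2 u3 x1 x2 x3 t).tsum_eq]
    exact norm_tsum_le_tsum_norm (FF_norm_hasSum u1 u2 u3 x1 x2 x3 t).summable
  obtain ⟨a1, b1⟩ := abs_lt.1 h1
  obtain ⟨a2, b2⟩ := abs_lt.1 h2
  obtain ⟨a3, b3⟩ := abs_lt.1 h3
  have hE0 : 0 < 1 - 4 * u1 ^ 2 := by nlinarith
  have hD0 : 0 < 1 - 4*u1^2 - 4*u2^2 - 4*u3^2 + 16*u1*u2*u3 := by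
    have s1 : u1 ^ 2 < 1 / 16 := by nlinarith
    have s2 : u2 ^ 2 < 1 / 16 := by nlinarith
    have s3 : u3 ^ 2 < 1 / 16 := by nlinarith
    have hp : |u1 * u2 * u3| ≤ 1 / 4 * (1 / 4) * (1 / 4) := by
      rw [abs_mul, abs_mul]; gcongr
    have := (abs_le.1 hp).1
    linarith
  have hval : ∫ t : ℝ × ℝ × ℝ, GG u1 u2 u3 x1 x2 x3 t.1 t.2.1 t.2.2 =
      ∫ t1 : ℝ, ∫ t2 : ℝ, ∫ t3 : ℝ, GG u1 u2 u3 x1 x2 x3 t1 t2 t3 := by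
    rw [Measure.volume_eq_prod] at hGint ⊢
    rw [integral_prod _ hGint]
    refine integral_congr_ae ?_
    filter_upwards [hGint.prod_right_ae] with t1 ht1
    rw [Measure.volume_eq_prod] at ht1 ⊢
    rw [integral_prod _ ht1]
  rw [hval, triple u1 u2 u3 x1 x2 x3 _ _ rfl hE0 rfl hD0] at hmain
  simp_rw [FF_integral] at hmain
  set D : ℝ := 1 - 4*u1^2 - 4*u2^2 - 4*u3^2 + 16*u1*u2*u3 with hD
  set E : ℝ := 1 - 4 * u1 ^ 2 with hE
  set X : ℝ := (x1^2 + x2^2 + x3^2) -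
          ((x1^2 + x2^2 + x3^2) - 4*(u1^2*x1^2 + u2^2*x2^2 + u3^2*x3^2)
            - 4*(u3*x1*x2 + u1*x2*x3 + u2*x3*x1)
            + 8*(u1*u2*x1*x2 + u2*u3*x2*x3 + u3*u1*x3*x1)) / D with hX
  have hpi : Real.sqrt Real.pi ≠ 0 := by positivity
  have hsum : HasSum T (D ^ (-(1:ℝ)/2) * Real.exp X) := by
    have hc : Real.sqrt Real.pi * Real.sqrt (Real.pi / E) * Real.sqrt (Real.pi / (D / E)) =
        D ^ (-(1:ℝ)/2) * Real.sqrt Real.pi ^ 3 := by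
      have hDp : D ^ (-(1:ℝ)/2) = (Real.sqrt D)⁻¹ := by
        rw [neg_div, Real.rpow_neg hD0.le, Real.sqrt_eq_rpow]
      rw [hDp, Real.sqrt_div Real.pi_pos.le, Real.sqrt_div Real.pi_pos.le, Real.sqrt_div hD0.le]
      have q1 : Real.sqrt E ≠ 0 := (Real.sqrt_pos.2 hE0).ne'
      have q2 : Real.sqrt D ≠ 0 := (Real.sqrt_pos.2 hD0).ne'
      field_simp
    have h := hmain.mul_right (((Real.sqrt Real.pi ^ 3)⁻¹ : ℝ) : ℂ)
    rw [← Complex.hasSum_ofReal]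
    have hpc : (Real.sqrt Real.pi : ℂ) ≠ 0 := by exact_mod_cast hpi
    refine HasSum.congr_both h ?_ ?_
    · intro q
      simp only [hT]
      push_cast
      field_simp
    · have hc' : (Real.sqrt Real.pi : ℂ) * (Real.sqrt (Real.pi / E) : ℂ) *
          (Real.sqrt (Real.pi / (D / E)) : ℂ) =
          ((D ^ (-(1:ℝ)/2) : ℝ) : ℂ) * (Real.sqrt Real.pi : ℂ) ^ 3 := by
        exact_mod_cast congrArg (fun r : ℝ => (r : ℂ)) hc
      rw [hc', hX]
      push_cast
      field_simp
  exact ⟨hsum.summable.abs, hsum.tsum_eq⟩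
end

section
/- Let r, s, t ∈ ℕ and let u_1, u_2, u_3 ∈ ℝ with |u_i| < 1/4 for each i. Define H(y) = Σ_{m,n,p ≥ 0} H_{n+p+r}(y_1) H_{p+m+s}(y_2) H_{m+n+t}(y_3) u_1^m u_2^n u_3^p / (m! n! p!) for y ∈ ℝ³ (the series converges absolutely). Then for every z = (z_1, z_2, z_3) ∈ ℂ³: ∫_{ℝ³} exp( 2(x_1 z_1 + x_2 z_2 + x_3 z_3) − 2|x|² ) · H(√2 x) dx = 2^{(r+s+t)/2} (π/2)^{3/2} · z_1^r z_2^s z_3^t · exp( (1/2)(z_1² + z_2² + z_3²) + 2(u_3 z_1 z_2 + u_1 z_2 z_3 + u_2 z_3 z_1) ). -/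
open MeasureTheory

/-- The triple Hermite series
`H(y) = Σ_{m,n,p} H_{n+p+r}(y₁) H_{p+m+s}(y₂) H_{m+n+t}(y₃) u₁^m u₂^n u₃^p / (m! n! p!)`. -/
noncomputable def Hser (r s t : ℕ) (u1 u2 u3 : ℝ) (y1 y2 y3 : ℝ) : ℝ :=
  ∑' q : ℕ × ℕ × ℕ,
    Hpoly (q.2.1 + q.2.2 + r) y1 * Hpoly (q.2.2 + q.1 + s) y2 * Hpoly (q.1 + q.2.1 + t) y3 *
      u1 ^ q.1 * u2 ^ q.2.1 * u3 ^ q.2.2 /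
      ((q.1.factorial : ℝ) * (q.2.1.factorial : ℝ) * (q.2.2.factorial : ℝ))

lemma aux_pow_le {b : ℝ} (hb : 0 < b) (ρ : ℝ) (N : ℕ) :
    ρ ^ N ≤ Real.sqrt (N.factorial / (2 * b) ^ N) * Real.exp (b * ρ ^ 2) := by
  have h := Real.pow_div_factorial_le_exp (x := 2 * b * ρ ^ 2) (by positivity) N
  have hf : (0 : ℝ) < N.factorial := by positivity
  have h2 : (0 : ℝ) < (2 * b) ^ N := by positivity
  apply le_of_sq_le_sq _ (by positivity)
  rw [mul_pow, Real.sq_sqrt (by positivity), ← Real.exp_nat_mul, div_mul_eq_mul_div,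
    le_div_iff₀ h2]
  rw [div_le_iff₀ hf] at h
  calc (ρ ^ N) ^ 2 * (2 * b) ^ N = (2 * b * ρ ^ 2) ^ N := by
        rw [mul_pow (2 * b), ← pow_mul, ← pow_mul, mul_comm N 2]; ring
    _ ≤ _ := h
    _ = _ := by rw [mul_comm]; congr 2; push_cast; ring

/-- The integrand of the integral representation. -/
noncomputable def Gint (n : ℕ) (x t : ℝ) : ℂ :=
  ((x : ℂ) + t * Complex.I) ^ n * Complex.exp (-(t : ℂ) ^ 2)

lemma norm_exp_neg_sq (t : ℝ) : ‖Complex.exp (-(t : ℂ) ^ 2)‖ = Real.exp (-t ^ 2) := by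
  rw [Complex.norm_exp]; norm_cast

lemma norm_lin (x t : ℝ) : ‖(x : ℂ) + t * Complex.I‖ ^ 2 = x ^ 2 + t ^ 2 := by
  rw [Complex.sq_norm, Complex.normSq_add_mul_I]

lemma Gint_bound {b c : ℝ} (hb : 0 < b) (hc : 0 < c) (N r : ℕ) (x t : ℝ) :
    ‖Gint (N + r) x t‖ ≤ Real.sqrt (N.factorial / (2 * b) ^ N) *
      Real.sqrt (r.factorial / (2 * c) ^ r) * Real.exp ((b + c) * x ^ 2) *
      Real.exp (-(1 - (b + c)) * t ^ 2) := by
  rw [Gint, norm_mul, norm_pow, norm_exp_neg_sq, pow_add]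
  have h1 := aux_pow_le hb ‖(x : ℂ) + t * Complex.I‖ N
  have h2 := aux_pow_le hc ‖(x : ℂ) + t * Complex.I‖ r
  rw [norm_lin] at h1 h2
  calc _ ≤ (Real.sqrt (N.factorial / (2 * b) ^ N) * Real.exp (b * (x ^ 2 + t ^ 2))) *
        (Real.sqrt (r.factorial / (2 * c) ^ r) * Real.exp (c * (x ^ 2 + t ^ 2))) *
        Real.exp (-t ^ 2) := by gcongr
    _ = Real.sqrt (N.factorial / (2 * b) ^ N) * Real.sqrt (r.factorial / (2 * c) ^ r) *
        (Real.exp (b * (x ^ 2 + t ^ 2)) * Real.exp (c * (x ^ 2 + t ^ 2)) *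
        Real.exp (-t ^ 2)) := by ring
    _ = _ := by
      rw [mul_assoc (_ * _) (Real.exp _), ← Real.exp_add, ← Real.exp_add, ← Real.exp_add]
      congr 2; ring

lemma Gint_integrable (n : ℕ) (x : ℝ) : Integrable (Gint n x) := by
  have hg := (integrable_exp_neg_mul_sq (b := 1 - (1/4 + 1/4 : ℝ)) (by norm_num)).const_mul
    (Real.sqrt (n.factorial / (2 * (1/4)) ^ n) *
      Real.sqrt ((0 : ℕ).factorial / (2 * (1/4)) ^ 0) * Real.exp ((1/4 + 1/4) * x ^ 2))
  refine hg.mono' ?_ (Filter.Eventually.of_forall fun t => ?_)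
  · apply Continuous.aestronglyMeasurable
    unfold Gint; fun_prop
  · exact Gint_bound (b := 1/4) (c := 1/4) (by norm_num) (by norm_num) n 0 x t

lemma G_zero (x : ℝ) : ∫ t, Gint 0 x t = (Real.sqrt Real.pi : ℂ) := by
  have h := integral_gaussian 1
  rw [div_one] at h
  rw [← h, ← integral_complex_ofReal]
  congr 1; ext t; simp [Gint]

lemma G_one (x : ℝ) : ∫ t, Gint 1 x t = x * (Real.sqrt Real.pi : ℂ) := by
  have key : ∀ t : ℝ, HasDerivAt (fun t : ℝ => Gint 0 x t)
      (2 * Complex.I * (Gint 1 x t - x * Gint 0 x t)) t := by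
    intro t
    have h : HasDerivAt (fun z : ℂ => ((x : ℂ) + z * Complex.I) ^ 0 * Complex.exp (-z ^ 2))
        (Complex.exp (-(t:ℂ) ^ 2) * (-(2 * t))) (t : ℂ) := by
      simpa using! ((hasDerivAt_pow 2 (t : ℂ)).neg).cexp
    convert! h.comp_ofReal using 1
    simp only [Gint]
    linear_combination (2 * Complex.exp (-(t:ℂ) ^ 2) * t) * Complex.I_sq
  have h := integral_eq_zero_of_hasDerivAt_of_integrable key
    (((Gint_integrable 1 x).sub ((Gint_integrable 0 x).const_mul _)).const_mul _)
    (Gint_integrable 0 x)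
  rw [integral_const_mul, integral_sub (Gint_integrable 1 x) ((Gint_integrable 0 x).const_mul _),
    integral_const_mul, G_zero] at h
  have := (mul_eq_zero.mp h).resolve_left (by simp)
  linear_combination this

lemma G_rec (n : ℕ) (x : ℝ) : ∫ t, Gint (n + 2) x t =
    x * (∫ t, Gint (n + 1) x t) - ((n + 1) / 2) * ∫ t, Gint n x t := by
  have key : ∀ t : ℝ, HasDerivAt (fun t : ℝ => Gint (n + 1) x t)
      (2 * Complex.I * ((Gint (n + 2) x t - x * Gint (n + 1) x t) +
        ((n + 1) / 2) * Gint n x t)) t := by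
    intro t
    have h0 : HasDerivAt (fun z : ℂ => (x : ℂ) + z * Complex.I) Complex.I (t : ℂ) := by
      simpa using! ((hasDerivAt_id (t : ℂ)).mul_const Complex.I).const_add (x : ℂ)
    have h := (h0.pow (n + 1)).mul (((hasDerivAt_pow 2 (t : ℂ)).neg).cexp)
    convert! h.comp_ofReal using 1
    simp only [Gint, Pi.neg_apply, Pi.pow_apply]
    push_cast
    norm_num
    linear_combination (2 * Complex.exp (-(t:ℂ) ^ 2) * t * ((x : ℂ) + t * Complex.I) ^ (n+1)) * Complex.I_sq
  have i1 := (Gint_integrable (n + 1) x).const_mul (x : ℂ)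
  have i0 := (Gint_integrable n x).const_mul (((n : ℂ) + 1) / 2)
  have i2 := Gint_integrable (n + 2) x
  have h := integral_eq_zero_of_hasDerivAt_of_integrable key
    (((i2.sub i1).add i0).const_mul _)
    (Gint_integrable (n + 1) x)
  rw [integral_const_mul, integral_add (f := fun t => Gint (n + 2) x t - x * Gint (n + 1) x t) (i2.sub i1) i0, integral_sub i2 i1,
    integral_const_mul, integral_const_mul] at h
  have := (mul_eq_zero.mp h).resolve_left (by simp)
  linear_combination this

lemma gauss_contDiff : ContDiff ℝ ⊤ (fun y : ℝ => Real.exp (-(y ^ 2))) := by fun_prop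

lemma F_hasDeriv (n : ℕ) (x : ℝ) :
    HasDerivAt (iteratedDeriv n (fun y : ℝ => Real.exp (-(y ^ 2))))
      (iteratedDeriv (n + 1) (fun y : ℝ => Real.exp (-(y ^ 2))) x) x := by
  rw [iteratedDeriv_succ]
  apply DifferentiableAt.hasDerivAt
  exact (gauss_contDiff.differentiable_iteratedDeriv n
    (by exact_mod_cast WithTop.coe_lt_top _)) x

lemma F_zero (x : ℝ) : iteratedDeriv 0 (fun y : ℝ => Real.exp (-(y ^ 2))) x
    = Real.exp (-(x ^ 2)) := by simp

lemma F_one (x : ℝ) : iteratedDeriv 1 (fun y : ℝ => Real.exp (-(y ^ 2))) x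
    = -2 * x * Real.exp (-(x ^ 2)) := by
  have h : HasDerivAt (fun y : ℝ => Real.exp (-(y ^ 2)))
      (Real.exp (-(x ^ 2)) * -(2 * x)) x := by
    simpa using! ((hasDerivAt_pow 2 x).neg).exp
  rw [iteratedDeriv_one, h.deriv]; ring

lemma F_rec (n : ℕ) : ∀ x : ℝ, iteratedDeriv (n + 2) (fun y : ℝ => Real.exp (-(y ^ 2))) x
    = -2 * x * iteratedDeriv (n + 1) (fun y : ℝ => Real.exp (-(y ^ 2))) x
      - 2 * (n + 1) * iteratedDeriv n (fun y : ℝ => Real.exp (-(y ^ 2))) x := by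
  induction n with
  | zero =>
    intro x
    have h1 := F_hasDeriv 1 x
    have h2 : HasDerivAt (iteratedDeriv 1 (fun y : ℝ => Real.exp (-(y ^ 2))))
        (-2 * Real.exp (-(x ^ 2)) + -2 * x *
          iteratedDeriv 1 (fun y : ℝ => Real.exp (-(y ^ 2))) x) x := by
      have h3 := ((hasDerivAt_id x).const_mul (-2)).mul (F_hasDeriv 0 x)
      have e : iteratedDeriv 1 (fun y : ℝ => Real.exp (-(y ^ 2))) =
        ((fun y => -2 * id y) * iteratedDeriv 0 (fun y : ℝ => Real.exp (-(y ^ 2)))) := by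
        funext y; rw [Pi.mul_apply, F_one, F_zero, id]
      rw [← e] at h3
      convert! h3 using 1
      simp
    rw [h1.unique h2, F_zero]; push_cast; ring
  | succ n ih =>
    intro x
    have h1 := F_hasDeriv (n + 2) x
    have h3 := (((hasDerivAt_id x).const_mul (-2)).mul (F_hasDeriv (n + 1) x)).sub
      ((F_hasDeriv n x).const_mul (2 * ((n : ℝ) + 1)))
    have e : iteratedDeriv (n + 2) (fun y : ℝ => Real.exp (-(y ^ 2))) =
        ((fun y => -2 * id y) * iteratedDeriv (n + 1) (fun y : ℝ => Real.exp (-(y ^ 2)))) -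
        (fun y => (2 * ((n : ℝ) + 1)) * iteratedDeriv n (fun y : ℝ => Real.exp (-(y ^ 2))) y) := by
      funext y; rw [ih y]; simp
    rw [← e] at h3
    rw [show n + 1 + 2 = n + 2 + 1 from rfl, h1.unique h3]
    simp only [id]; push_cast; ring

lemma Hpoly_zero (x : ℝ) : Hpoly 0 x = 1 := by
  rw [Hpoly, F_zero, mul_assoc, ← Real.exp_add]; simp

lemma Hpoly_one (x : ℝ) : Hpoly 1 x = 2 * x := by
  have : Real.exp (x ^ 2) * Real.exp (-(x ^ 2)) = 1 := by rw [← Real.exp_add]; simp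
  rw [Hpoly, F_one]; linear_combination (2 * x) * this

lemma Hpoly_rec (n : ℕ) (x : ℝ) : Hpoly (n + 2) x = 2 * x * Hpoly (n + 1) x -
    2 * (n + 1) * Hpoly n x := by
  simp only [Hpoly, F_rec]; ring

lemma Hpoly_integral (x : ℝ) (n : ℕ) :
    (Real.sqrt Real.pi : ℂ) * (Hpoly n x : ℂ) = 2 ^ n * ∫ t, Gint n x t := by
  induction n using Nat.twoStepInduction with
  | zero => rw [G_zero, Hpoly_zero]; simp
  | one => rw [G_one, Hpoly_one]; push_cast; ring
  | more n h0 h1 =>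
    rw [G_rec, Hpoly_rec]; push_cast
    linear_combination (2 * (x : ℂ)) * h1 - 2 * ((n : ℂ) + 1) * h0

lemma Hpoly_bound {a b : ℝ} (hb : 0 < b) (hba : b < a) (ha : a < 1) (r : ℕ) :
    ∃ C : ℝ, 0 ≤ C ∧ ∀ (N : ℕ) (y : ℝ), |Hpoly (N + r) y| ≤
      C * Real.sqrt (N.factorial * (2 / b) ^ N) * Real.exp (a * y ^ 2) := by
  have hpi : 0 < Real.sqrt Real.pi := Real.sqrt_pos.mpr Real.pi_pos
  set K := ∫ t : ℝ, Real.exp (-(1 - a) * t ^ 2) with hK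
  have hK0 : 0 ≤ K := integral_nonneg fun t => (Real.exp_pos _).le
  refine ⟨2 ^ r / Real.sqrt Real.pi * Real.sqrt (r.factorial / (2 * (a - b)) ^ r) * K,
    by positivity, fun N y => ?_⟩
  have h1 := congrArg norm (Hpoly_integral y (N + r))
  rw [norm_mul, norm_mul, Complex.norm_real, Complex.norm_real, Real.norm_eq_abs,
    Real.norm_eq_abs, abs_of_pos hpi, norm_pow, Complex.norm_ofNat] at h1
  have h2 : ‖∫ t, Gint (N + r) y t‖ ≤ ∫ t : ℝ, Real.sqrt (N.factorial / (2 * b) ^ N) *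
      Real.sqrt (r.factorial / (2 * (a - b)) ^ r) * Real.exp (a * y ^ 2) *
      Real.exp (-(1 - a) * t ^ 2) := by
    apply norm_integral_le_of_norm_le
    · exact (integrable_exp_neg_mul_sq (by linarith)).const_mul _
    · refine Filter.Eventually.of_forall fun t => ?_
      have := Gint_bound hb (sub_pos.mpr hba) N r y t
      rwa [add_sub_cancel] at this
  rw [integral_const_mul, ← hK] at h2
  have h3 : (2 : ℝ) ^ N * Real.sqrt (N.factorial / (2 * b) ^ N) =
      Real.sqrt (N.factorial * (2 / b) ^ N) := by
    rw [← Real.sqrt_sq (show (0 : ℝ) ≤ 2 ^ N by positivity), ← Real.sqrt_mul (by positivity)]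
    congr 1
    rw [mul_pow, div_pow]; field_simp
  rw [← h3]
  have h4 : |Hpoly (N + r) y| = 2 ^ (N + r) * ‖∫ t, Gint (N + r) y t‖ / Real.sqrt Real.pi := by
    rw [← h1]; field_simp
  rw [h4, div_le_iff₀ hpi]
  calc _ ≤ 2 ^ (N + r) * (Real.sqrt (N.factorial / (2 * b) ^ N) *
      Real.sqrt (r.factorial / (2 * (a - b)) ^ r) * Real.exp (a * y ^ 2) * K) := by gcongr
    _ = _ := by rw [pow_add]; field_simp

/-- The one-dimensional integrand. -/
noncomputable def Jint (z : ℂ) (n : ℕ) (x : ℝ) : ℂ :=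
  Complex.exp (2 * (x * z) - 2 * ((x ^ 2 : ℝ) : ℂ)) * (Hpoly n (Real.sqrt 2 * x) : ℂ)

lemma Hpoly_continuous (n : ℕ) : Continuous (Hpoly n) := by
  unfold Hpoly
  have : Continuous (iteratedDeriv n (fun y : ℝ => Real.exp (-(y ^ 2)))) :=
    continuous_iff_continuousAt.mpr fun x => (F_hasDeriv n x).continuousAt
  fun_prop

lemma Jint_continuous (z : ℂ) (n : ℕ) : Continuous (Jint z n) := by
  unfold Jint
  have := Hpoly_continuous n
  fun_prop

lemma Jint_bound (z : ℂ) {a b : ℝ} (hb : 0 < b) (hba : b < a) (ha : a < 1) (r : ℕ) :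
    ∃ C : ℝ, 0 ≤ C ∧ ∀ N : ℕ, Integrable (Jint z (N + r)) ∧
      ∫ x, ‖Jint z (N + r) x‖ ≤ C * Real.sqrt (N.factorial * (2 / b) ^ N) := by
  obtain ⟨C, hC, h⟩ := Hpoly_bound hb hba ha r
  have hD : Integrable fun x : ℝ =>
      ‖Complex.exp (-((2 - 2 * a : ℝ) : ℂ) * (x : ℂ) ^ 2 + (2 * z) * x + 0)‖ :=
    (integrable_cexp_quadratic (by rw [Complex.ofReal_re]; linarith) _ _).norm
  set D := fun x : ℝ =>
      ‖Complex.exp (-((2 - 2 * a : ℝ) : ℂ) * (x : ℂ) ^ 2 + (2 * z) * x + 0)‖ with hDdef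
  have hle : ∀ (N : ℕ) (x : ℝ), ‖Jint z (N + r) x‖ ≤
      C * Real.sqrt (N.factorial * (2 / b) ^ N) * D x := by
    intro N x
    rw [Jint, norm_mul, Complex.norm_real, Real.norm_eq_abs]
    have h1 := h N (Real.sqrt 2 * x)
    have h2 : ‖Complex.exp (2 * (x * z) - 2 * ((x ^ 2 : ℝ) : ℂ))‖ *
        Real.exp (a * (Real.sqrt 2 * x) ^ 2) = D x := by
      rw [hDdef, mul_pow, Real.sq_sqrt (by norm_num)]
      simp only
      rw [Complex.norm_exp, Complex.norm_exp, ← Real.exp_add]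
      congr 1
      rw [← Complex.ofReal_re (a * (2 * x ^ 2)), ← Complex.add_re]
      congr 1
      push_cast; ring
    calc _ ≤ ‖Complex.exp (2 * (x * z) - 2 * ((x ^ 2 : ℝ) : ℂ))‖ *
          (C * Real.sqrt (N.factorial * (2 / b) ^ N) *
            Real.exp (a * (Real.sqrt 2 * x) ^ 2)) := by gcongr
      _ = _ := by rw [← h2]; ring
  have hI : ∀ N : ℕ, Integrable (Jint z (N + r)) := fun N =>
    (hD.const_mul (C * Real.sqrt (N.factorial * (2 / b) ^ N))).mono'
      (Jint_continuous z _).aestronglyMeasurable (Filter.Eventually.of_forall (hle N))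
  refine ⟨C * ∫ x, D x, mul_nonneg hC (integral_nonneg fun x => norm_nonneg _),
    fun N => ⟨hI N, ?_⟩⟩
  calc _ ≤ ∫ x, C * Real.sqrt (N.factorial * (2 / b) ^ N) * D x :=
        integral_mono (hI N).norm (hD.const_mul _) (hle N)
    _ = _ := by rw [integral_const_mul]; ring

lemma Jint_integrable (z : ℂ) (n : ℕ) : Integrable (Jint z n) := by
  obtain ⟨C, -, h⟩ := Jint_bound z (a := 1/2) (b := 1/4) (by norm_num) (by norm_num)
    (by norm_num) 0
  exact (h n).1

lemma Jint_eq (z : ℂ) (n : ℕ) (x : ℝ) : Jint z n x = (-1) ^ n * Complex.exp (2 * (x * z)) *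
    (iteratedDeriv n (fun y : ℝ => Real.exp (-(y ^ 2))) (Real.sqrt 2 * x) : ℝ) := by
  rw [Jint, Hpoly, mul_pow, Real.sq_sqrt (by norm_num)]
  push_cast
  have : Complex.exp (2 * (x * z) - 2 * (x : ℂ) ^ 2) * Complex.exp (2 * (x : ℂ) ^ 2) =
    Complex.exp (2 * (x * z)) := by rw [← Complex.exp_add]; congr 1; ring
  rw [← this]; ring

lemma Jint_integral_zero (z : ℂ) : ∫ x, Jint z 0 x =
    (Real.sqrt (Real.pi / 2) : ℂ) * Complex.exp (z ^ 2 / 2) := by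
  have h := integral_cexp_quadratic (b := -2) (by norm_num) (2 * z) 0
  have e : ∀ x : ℝ, Jint z 0 x = Complex.exp (-2 * (x : ℂ) ^ 2 + 2 * z * x + 0) := by
    intro x
    rw [Jint, Hpoly_zero]; push_cast; rw [mul_one]; congr 1; ring
  simp_rw [e]
  rw [h]
  congr 1
  · rw [Real.sqrt_eq_rpow, Complex.ofReal_cpow (by positivity)]
    push_cast; norm_num
  · congr 1; ring

lemma Jint_integral_succ (z : ℂ) (n : ℕ) : ∫ x, Jint z (n + 1) x =
    (Real.sqrt 2 : ℂ) * z * ∫ x, Jint z n x := by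
  have h2 : (Real.sqrt 2 : ℂ) * (Real.sqrt 2 : ℂ) = 2 := by
    rw [← Complex.ofReal_mul, Real.mul_self_sqrt (by norm_num)]; simp
  have h2n : (Real.sqrt 2 : ℂ) ≠ 0 := by
    intro h; rw [h] at h2; simp at h2
  have key : ∀ x : ℝ, HasDerivAt (fun x : ℝ => Jint z n x)
      (2 * z * Jint z n x - (Real.sqrt 2 : ℂ) * Jint z (n + 1) x) x := by
    intro x
    have hl : HasDerivAt (fun x : ℝ => Real.sqrt 2 * x) (Real.sqrt 2) x := by
      simpa using! (hasDerivAt_id x).const_mul (Real.sqrt 2)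
    have h1 := ((F_hasDeriv n (Real.sqrt 2 * x)).comp x hl).ofReal_comp
    have hlin : HasDerivAt (fun w : ℂ => 2 * (w * z)) (2 * z) (x : ℂ) := by
      simpa using! ((hasDerivAt_id (x : ℂ)).mul_const z).const_mul 2
    have h3 := ((hlin.cexp.comp_ofReal).const_mul ((-1 : ℂ) ^ n)).mul h1
    convert! h3 using 1
    · funext y; exact Jint_eq z n y
    · rw [Jint_eq, Jint_eq]; simp only [Function.comp]; push_cast; ring
  have i0 := (Jint_integrable z n).const_mul (2 * z)
  have i1 := (Jint_integrable z (n + 1)).const_mul (Real.sqrt 2 : ℂ)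
  have h := integral_eq_zero_of_hasDerivAt_of_integrable key (i0.sub i1) (Jint_integrable z n)
  rw [integral_sub i0 i1, integral_const_mul, integral_const_mul] at h
  apply mul_left_cancel₀ h2n
  linear_combination -h - (z * ∫ x, Jint z n x) * h2

lemma Jint_integral (z : ℂ) (n : ℕ) : ∫ x, Jint z n x =
    ((Real.sqrt 2 : ℂ) * z) ^ n * ((Real.sqrt (Real.pi / 2) : ℂ) * Complex.exp (z ^ 2 / 2)) := by
  induction n with
  | zero => rw [Jint_integral_zero]; simp
  | succ n ih => rw [Jint_integral_succ, ih]; ring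

lemma sqrt_split {b : ℝ} (hb : 0 < b) (n p : ℕ) :
    Real.sqrt ((n + p).factorial * (2 / b) ^ (n + p)) ≤
      Real.sqrt (n.factorial * (4 / b) ^ n) * Real.sqrt (p.factorial * (4 / b) ^ p) := by
  rw [← Real.sqrt_mul (by positivity)]
  apply Real.sqrt_le_sqrt
  have h1 : ((n + p).factorial : ℝ) ≤ 2 ^ (n + p) * n.factorial * p.factorial := by
    rw [← Nat.add_choose_mul_factorial_mul_factorial n p]
    push_cast
    gcongr
    exact_mod_cast Nat.choose_le_two_pow (n + p) p
  calc _ ≤ (2 ^ (n + p) * n.factorial * p.factorial) * (2 / b) ^ (n + p) := by gcongr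
    _ = _ := by
      rw [show (4 : ℝ) / b = 2 * (2 / b) by ring, mul_pow, mul_pow, pow_add, pow_add]; ring

lemma summ_aux {b : ℝ} (hb : 0 < b) (u1 u2 u3 : ℝ) (h1 : 4 * |u1| < b) (h2 : 4 * |u2| < b)
    (h3 : 4 * |u3| < b) (A B D : ℕ → ℝ) (K1 K2 K3 : ℝ) (k1 : 0 ≤ K1) (k2 : 0 ≤ K2) (k3 : 0 ≤ K3)
    (hA : ∀ N : ℕ, |A N| ≤ K1 * Real.sqrt (N.factorial * (2 / b) ^ N))
    (hB : ∀ N : ℕ, |B N| ≤ K2 * Real.sqrt (N.factorial * (2 / b) ^ N))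
    (hD : ∀ N : ℕ, |D N| ≤ K3 * Real.sqrt (N.factorial * (2 / b) ^ N)) :
    Summable fun q : ℕ × ℕ × ℕ => |A (q.2.1 + q.2.2) * B (q.2.2 + q.1) * D (q.1 + q.2.1) *
      u1 ^ q.1 * u2 ^ q.2.1 * u3 ^ q.2.2 /
      ((q.1.factorial : ℝ) * (q.2.1.factorial : ℝ) * (q.2.2.factorial : ℝ))| := by
  have g : ∀ u : ℝ, 4 * |u| < b → Summable fun m : ℕ => ‖(4 / b * |u|) ^ m‖ := by
    intro u hu
    have hn : ∀ m : ℕ, ‖(4 / b * |u|) ^ m‖ = (4 / b * |u|) ^ m := fun m =>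
      Real.norm_of_nonneg (by positivity)
    simp_rw [hn]
    apply summable_geometric_of_lt_one (by positivity)
    rw [div_mul_eq_mul_div, div_lt_one hb]; exact hu
  have S := (summable_mul_of_summable_norm (g u1 h1)
    (summable_mul_of_summable_norm (g u2 h2) (g u3 h3)).norm).mul_left (K1 * K2 * K3)
  refine Summable.of_nonneg_of_le (fun q => abs_nonneg _) ?_ S
  rintro ⟨m, n, p⟩
  simp only
  rw [abs_div, abs_mul, abs_mul, abs_mul, abs_mul, abs_mul, abs_pow, abs_pow, abs_pow,
    abs_of_pos (show (0 : ℝ) < m.factorial * n.factorial * p.factorial by positivity),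
    div_le_iff₀ (by positivity)]
  have sq : ∀ m : ℕ, Real.sqrt (m.factorial * (4 / b) ^ m) * Real.sqrt (m.factorial * (4 / b) ^ m)
      = m.factorial * (4 / b) ^ m := fun m => Real.mul_self_sqrt (by positivity)
  have a1 := (hA (n + p)).trans (mul_le_mul_of_nonneg_left (sqrt_split hb n p) k1)
  have a2 := (hB (p + m)).trans (mul_le_mul_of_nonneg_left (sqrt_split hb p m) k2)
  have a3 := (hD (m + n)).trans (mul_le_mul_of_nonneg_left (sqrt_split hb m n) k3)
  have sm := sq m
  have sn := sq n
  have sp := sq p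
  set σm := Real.sqrt (m.factorial * (4 / b) ^ m)
  set σn := Real.sqrt (n.factorial * (4 / b) ^ n)
  set σp := Real.sqrt (p.factorial * (4 / b) ^ p)
  calc _ ≤ (K1 * (σn * σp)) * (K2 * (σp * σm)) * (K3 * (σm * σn)) * |u1| ^ m * |u2| ^ n * |u3| ^ p
        := by gcongr
    _ = K1 * K2 * K3 * (σm * σm) * (σn * σn) * (σp * σp) * |u1| ^ m * |u2| ^ n * |u3| ^ p := by ring
    _ = _ := by rw [sm, sn, sp, mul_pow, mul_pow, mul_pow]; ring

lemma prod3 {𝕜 : Type*} [RCLike 𝕜] (f g h : ℝ → 𝕜) (hf : Integrable f) (hg : Integrable g)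
    (hh : Integrable h) :
    Integrable (fun x : Fin 3 → ℝ => f (x 0) * g (x 1) * h (x 2)) ∧
    ∫ x : Fin 3 → ℝ, f (x 0) * g (x 1) * h (x 2) = (∫ x, f x) * (∫ x, g x) * ∫ x, h x := by
  constructor
  · have := Integrable.fintype_prod (ι := Fin 3) (E := ℝ) (f := ![f, g, h])
      (μ := fun _ => volume) (by intro i; fin_cases i <;> assumption)
    simpa [Fin.prod_univ_three] using! this
  · have := integral_fintype_prod_volume_eq_prod (ι := Fin 3) (E := fun _ => ℝ) ![f, g, h]
    simpa [Fin.prod_univ_three] using! this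

lemma tsum3 (a b c : ℂ) : ∑' q : ℕ × ℕ × ℕ, a ^ q.1 / (q.1.factorial : ℂ) *
    (b ^ q.2.1 / (q.2.1.factorial : ℂ) * (c ^ q.2.2 / (q.2.2.factorial : ℂ))) =
    Complex.exp a * (Complex.exp b * Complex.exp c) := by
  have e : ∀ a : ℂ, Complex.exp a = ∑' n : ℕ, a ^ n / (n.factorial : ℂ) := by
    intro a
    rw [Complex.exp_eq_exp_ℂ, NormedSpace.exp_eq_tsum_div]
  have s : ∀ a : ℂ, Summable fun n : ℕ => ‖a ^ n / (n.factorial : ℂ)‖ :=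
    fun a => NormedSpace.norm_expSeries_div_summable a
  rw [e a, e b, e c, tsum_mul_tsum_of_summable_norm (s b) (s c),
    tsum_mul_tsum_of_summable_norm (s a) (summable_mul_of_summable_norm (s b) (s c)).norm]

theorem stmt9 (r s t : ℕ) (u1 u2 u3 : ℝ)
    (h1 : |u1| < 1/4) (h2 : |u2| < 1/4) (h3 : |u3| < 1/4) :
    (∀ y1 y2 y3 : ℝ, Summable (fun q : ℕ × ℕ × ℕ =>
      |Hpoly (q.2.1 + q.2.2 + r) y1 * Hpoly (q.2.2 + q.1 + s) y2 *
        Hpoly (q.1 + q.2.1 + t) y3 * u1 ^ q.1 * u2 ^ q.2.1 * u3 ^ q.2.2 /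
        ((q.1.factorial : ℝ) * (q.2.1.factorial : ℝ) * (q.2.2.factorial : ℝ))|)) ∧
    ∀ z1 z2 z3 : ℂ,
      (∫ x : Fin 3 → ℝ,
          Complex.exp (2 * ((x 0 : ℂ) * z1 + (x 1 : ℂ) * z2 + (x 2 : ℂ) * z3)
            - 2 * (((x 0)^2 + (x 1)^2 + (x 2)^2 : ℝ) : ℂ)) *
          (Hser r s t u1 u2 u3 (Real.sqrt 2 * x 0) (Real.sqrt 2 * x 1)
            (Real.sqrt 2 * x 2) : ℂ))
        = (((2 : ℝ) ^ (((r + s + t : ℕ) : ℝ)/2) * (Real.pi / 2) ^ ((3 : ℝ)/2) : ℝ) : ℂ) *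
          z1 ^ r * z2 ^ s * z3 ^ t *
          Complex.exp ((1/2) * (z1^2 + z2^2 + z3^2)
            + 2 * (u3 * z1 * z2 + u1 * z2 * z3 + u2 * z3 * z1)) := by
  obtain ⟨b, hbm, hb1⟩ : ∃ b, max (max (4 * |u1|) (4 * |u2|)) (4 * |u3|) < b ∧ b < 1 := by
    apply exists_between
    simp only [max_lt_iff]
    exact ⟨⟨by linarith, by linarith⟩, by linarith⟩
  simp only [max_lt_iff] at hbm
  obtain ⟨⟨b1, b2⟩, b3⟩ := hbm
  have hb : 0 < b := lt_of_le_of_lt (by positivity) b1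
  obtain ⟨a, hba, ha⟩ := exists_between hb1
  constructor
  · intro y1 y2 y3
    obtain ⟨C1, hC1, B1⟩ := Hpoly_bound hb hba ha r
    obtain ⟨C2, hC2, B2⟩ := Hpoly_bound hb hba ha s
    obtain ⟨C3, hC3, B3⟩ := Hpoly_bound hb hba ha t
    refine summ_aux hb u1 u2 u3 b1 b2 b3 (fun N => Hpoly (N + r) y1) (fun N => Hpoly (N + s) y2)
      (fun N => Hpoly (N + t) y3) (C1 * Real.exp (a * y1 ^ 2)) (C2 * Real.exp (a * y2 ^ 2))
      (C3 * Real.exp (a * y3 ^ 2)) (by positivity) (by positivity) (by positivity) ?_ ?_ ?_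
    · intro N; exact (B1 N y1).trans_eq (by ring)
    · intro N; exact (B2 N y2).trans_eq (by ring)
    · intro N; exact (B3 N y3).trans_eq (by ring)
  · intro z1 z2 z3
    obtain ⟨C1, hC1, B1⟩ := Jint_bound z1 hb hba ha r
    obtain ⟨C2, hC2, B2⟩ := Jint_bound z2 hb hba ha s
    obtain ⟨C3, hC3, B3⟩ := Jint_bound z3 hb hba ha t
    set c : ℕ × ℕ × ℕ → ℝ := fun q => u1 ^ q.1 * u2 ^ q.2.1 * u3 ^ q.2.2 /
      ((q.1.factorial : ℝ) * (q.2.1.factorial : ℝ) * (q.2.2.factorial : ℝ)) with hc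
    set F : ℕ × ℕ × ℕ → (Fin 3 → ℝ) → ℂ := fun q x => (c q : ℂ) *
      (Jint z1 (q.2.1 + q.2.2 + r) (x 0) * Jint z2 (q.2.2 + q.1 + s) (x 1) *
        Jint z3 (q.1 + q.2.1 + t) (x 2)) with hF
    have P := fun q : ℕ × ℕ × ℕ => prod3 _ _ _ (Jint_integrable z1 (q.2.1 + q.2.2 + r))
      (Jint_integrable z2 (q.2.2 + q.1 + s)) (Jint_integrable z3 (q.1 + q.2.1 + t))
    have PN := fun q : ℕ × ℕ × ℕ => prod3 _ _ _ (Jint_integrable z1 (q.2.1 + q.2.2 + r)).norm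
      (Jint_integrable z2 (q.2.2 + q.1 + s)).norm (Jint_integrable z3 (q.1 + q.2.1 + t)).norm
    have hFint : ∀ q, Integrable (F q) := fun q => (P q).1.const_mul _
    have hsum : Summable fun q => ∫ x, ‖F q x‖ := by
      have S := summ_aux hb u1 u2 u3 b1 b2 b3 (fun N => ∫ x, ‖Jint z1 (N + r) x‖)
        (fun N => ∫ x, ‖Jint z2 (N + s) x‖) (fun N => ∫ x, ‖Jint z3 (N + t) x‖) C1 C2 C3
        hC1 hC2 hC3
        (fun N => by rw [abs_of_nonneg (integral_nonneg fun x => norm_nonneg _)]; exact (B1 N).2)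
        (fun N => by rw [abs_of_nonneg (integral_nonneg fun x => norm_nonneg _)]; exact (B2 N).2)
        (fun N => by rw [abs_of_nonneg (integral_nonneg fun x => norm_nonneg _)]; exact (B3 N).2)
      refine S.congr fun q => ?_
      simp only [hF, norm_mul, Complex.norm_real, Real.norm_eq_abs]
      rw [integral_const_mul, (PN q).2]
      have e1 : 0 ≤ ∫ x, ‖Jint z1 (q.2.1 + q.2.2 + r) x‖ := integral_nonneg fun x => norm_nonneg _
      have e2 : 0 ≤ ∫ x, ‖Jint z2 (q.2.2 + q.1 + s) x‖ := integral_nonneg fun x => norm_nonneg _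
      have e3 : 0 ≤ ∫ x, ‖Jint z3 (q.1 + q.2.1 + t) x‖ := integral_nonneg fun x => norm_nonneg _
      rw [← abs_of_nonneg (mul_nonneg (mul_nonneg e1 e2) e3), ← abs_mul]
      congr 1
      rw [abs_of_nonneg (mul_nonneg (mul_nonneg e1 e2) e3)]
      simp only [hc]; ring
    have H := hasSum_integral_of_summable_integral_norm hFint hsum
    have hpt : ∀ x : Fin 3 → ℝ,
        Complex.exp (2 * ((x 0 : ℂ) * z1 + (x 1 : ℂ) * z2 + (x 2 : ℂ) * z3)
            - 2 * (((x 0)^2 + (x 1)^2 + (x 2)^2 : ℝ) : ℂ)) *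
          (Hser r s t u1 u2 u3 (Real.sqrt 2 * x 0) (Real.sqrt 2 * x 1)
            (Real.sqrt 2 * x 2) : ℂ) = ∑' q, F q x := by
      intro x
      rw [Hser, Complex.ofReal_tsum, ← tsum_mul_left]
      congr 1; funext q
      have he : Complex.exp (2 * ((x 0 : ℂ) * z1 + (x 1 : ℂ) * z2 + (x 2 : ℂ) * z3)
            - 2 * (((x 0)^2 + (x 1)^2 + (x 2)^2 : ℝ) : ℂ)) =
          Complex.exp (2 * ((x 0 : ℂ) * z1) - 2 * (((x 0) ^ 2 : ℝ) : ℂ)) *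
          Complex.exp (2 * ((x 1 : ℂ) * z2) - 2 * (((x 1) ^ 2 : ℝ) : ℂ)) *
          Complex.exp (2 * ((x 2 : ℂ) * z3) - 2 * (((x 2) ^ 2 : ℝ) : ℂ)) := by
        rw [← Complex.exp_add, ← Complex.exp_add]; congr 1; push_cast; ring
      rw [he]
      simp only [hF, hc, Jint]
      push_cast
      ring
    simp_rw [hpt]
    rw [← H.tsum_eq]
    have h2 : (Real.sqrt 2 : ℂ) * (Real.sqrt 2 : ℂ) = 2 := by
      rw [← Complex.ofReal_mul, Real.mul_self_sqrt (by norm_num)]; simp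
    have r1 : (2 : ℝ) ^ (((r + s + t : ℕ) : ℝ)/2) = Real.sqrt 2 ^ (r + s + t) := by
      rw [Real.sqrt_eq_rpow, ← Real.rpow_natCast, ← Real.rpow_mul (by norm_num)]
      congr 1; ring
    have r2 : (Real.pi / 2) ^ ((3 : ℝ)/2) = Real.sqrt (Real.pi / 2) ^ 3 := by
      rw [Real.sqrt_eq_rpow, ← Real.rpow_natCast, ← Real.rpow_mul (by positivity)]
      congr 1; norm_num
    have hterm : ∀ q : ℕ × ℕ × ℕ, ∫ x, F q x =
        ((Real.sqrt 2 : ℂ) ^ (r + s + t) * (Real.sqrt (Real.pi / 2) : ℂ) ^ 3 *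
          z1 ^ r * z2 ^ s * z3 ^ t * (Complex.exp (z1 ^ 2 / 2) * Complex.exp (z2 ^ 2 / 2) *
            Complex.exp (z3 ^ 2 / 2))) *
        ((2 * (u1 * z2 * z3)) ^ q.1 / (q.1.factorial : ℂ) *
          ((2 * (u2 * z3 * z1)) ^ q.2.1 / (q.2.1.factorial : ℂ) *
            ((2 * (u3 * z1 * z2)) ^ q.2.2 / (q.2.2.factorial : ℂ)))) := by
      intro q
      simp only [hF]
      rw [integral_const_mul, (P q).2, Jint_integral, Jint_integral, Jint_integral]
      simp only [hc, ← h2]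
      push_cast
      ring
    simp_rw [hterm]
    rw [tsum_mul_left, tsum3, r1, r2]
    have he : Complex.exp ((1/2) * (z1^2 + z2^2 + z3^2)
            + 2 * (u3 * z1 * z2 + u1 * z2 * z3 + u2 * z3 * z1)) =
        (Complex.exp (z1 ^ 2 / 2) * Complex.exp (z2 ^ 2 / 2) * Complex.exp (z3 ^ 2 / 2)) *
        (Complex.exp (2 * (u1 * z2 * z3)) * (Complex.exp (2 * (u2 * z3 * z1)) *
          Complex.exp (2 * (u3 * z1 * z2)))) := by
      simp only [← Complex.exp_add]; congr 1; ring
    rw [he]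
    push_cast
    ring
end
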